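/- Let V be a finite ground set, f : Finset V → ℝ a nonnegative submodular function, a ∈ [0,1], and S ⊆ V a finite set. Let x ∈ [0,1]^V satisfy x_e ≤ a for every e ∈ V. Then the multilinear extension satisfies F(x ∨ 1_S) ≥ (1 − a)·f(S), where (x ∨ 1_S)_e = max{x_e, (1_S)_e}. -/

import Mathlib

open Finset

/-- The multilinear extension of a set function `f`:
`F(x) = ∑_{T ⊆ V} f(T) · ∏_{e ∈ T} x_e · ∏_{e ∉ T} (1 - x_e)`. -/
noncomputable def multilinearExt {V : Type*} [Fintype V] [DecidableEq V]
    (f : Finset V → ℝ) (x : V → ℝ) : ℝ :=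
  ∑ T : Finset V, f T * ((∏ e ∈ T, x e) * ∏ e ∈ Tᶜ, (1 - x e))

theorem aux_sum {V : Type*} [DecidableEq V] (y : V → ℝ) (U : Finset V) :
    ∑ T ∈ U.powerset, ((∏ e ∈ T, y e) * ∏ e ∈ U \ T, (1 - y e)) = 1 := by
  rw [← Finset.prod_add]
  simp

theorem aux_insert {V : Type*} [DecidableEq V] (g : Finset V → ℝ) (y : V → ℝ)
    (U : Finset V) (e : V) (he : e ∉ U) :
    ∑ T ∈ (insert e U).powerset, g T * ((∏ i ∈ T, y i) * ∏ i ∈ insert e U \ T, (1 - y i))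
      = ∑ T ∈ U.powerset, (g T + y e * (g (insert e T) - g T)) *
          ((∏ i ∈ T, y i) * ∏ i ∈ U \ T, (1 - y i)) := by
  rw [Finset.sum_powerset_insert he, ← Finset.sum_add_distrib]
  refine Finset.sum_congr rfl fun T hT => ?_
  have hTU := Finset.mem_powerset.1 hT
  have heT : e ∉ T := fun h => he (hTU h)
  have h1 : insert e U \ T = insert e (U \ T) := Finset.insert_sdiff_of_notMem _ heT
  have h2 : insert e U \ insert e T = U \ T := by
    ext i; simp only [Finset.mem_sdiff, Finset.mem_insert]; grind
  rw [h1, h2, Finset.prod_insert (by simp [he]), Finset.prod_insert heT]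
  ring

theorem aux_main {V : Type*} [DecidableEq V]
    (f : Finset V → ℝ)
    (hsub : ∀ A B : Finset V, A ⊆ B → ∀ e ∉ B,
      f (insert e A) - f A ≥ f (insert e B) - f B)
    (hnn : ∀ S : Finset V, 0 ≤ f S)
    (a : ℝ) (S : Finset V) (x y : V → ℝ)
    (hx : ∀ e, 0 ≤ x e) (hxa : ∀ e, x e ≤ a)
    (hy : ∀ e, 0 ≤ y e ∧ y e ≤ 1) (hyx : ∀ e ∉ S, y e = x e) (U : Finset V) :
    ∀ m : ℝ, m ≤ a → (∀ e ∈ U, m ≤ x e) →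
    (1 - a) * f S + m * f (S ∪ U) ≤
      ∑ T ∈ U.powerset, f (S ∪ T) * ((∏ i ∈ T, y i) * ∏ i ∈ U \ T, (1 - y i)) := by
  induction U using Finset.induction_on_min_value x with
  | empty =>
    intro m hm _
    simp
    nlinarith [hnn S]
  | insert e U he hmin ih =>
    intro m hm hmU
    rw [aux_insert (fun T => f (S ∪ T)) y U e he]
    simp only [Finset.union_insert]
    by_cases heS : e ∈ S
    · have h3 : ∀ T : Finset V, insert e (S ∪ T) = S ∪ T := fun T =>
        Finset.insert_eq_of_mem (Finset.mem_union_left _ heS)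
      simp only [h3, sub_self, mul_zero, add_zero]
      exact ih m hm fun i hi => hmU i (Finset.mem_insert_of_mem hi)
    · have h4 := ih (x e) (hxa e) hmin
      have hmx := hmU e (Finset.mem_insert_self _ _)
      have h5 : ∑ T ∈ U.powerset, (f (S ∪ T) + y e * (f (insert e (S ∪ U)) - f (S ∪ U))) *
          ((∏ i ∈ T, y i) * ∏ i ∈ U \ T, (1 - y i)) ≤
          ∑ T ∈ U.powerset, (f (S ∪ T) + y e * (f (insert e (S ∪ T)) - f (S ∪ T))) *
          ((∏ i ∈ T, y i) * ∏ i ∈ U \ T, (1 - y i)) := by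
        refine Finset.sum_le_sum fun T hT => ?_
        have hTU := Finset.mem_powerset.1 hT
        refine mul_le_mul_of_nonneg_right ?_ (mul_nonneg
          (Finset.prod_nonneg fun i _ => (hy i).1)
          (Finset.prod_nonneg fun i _ => sub_nonneg.2 (hy i).2))
        have := hsub (S ∪ T) (S ∪ U) (Finset.union_subset_union_right hTU) e
          (by simp [heS, he])
        have := mul_le_mul_of_nonneg_left this (hy e).1
        linarith
      refine le_trans ?_ h5
      simp only [add_mul, Finset.sum_add_distrib]
      rw [← Finset.mul_sum, aux_sum, hyx e heS]
      nlinarith [hnn (insert e (S ∪ U))]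

/-- for a nonnegative submodular `f`, if `x_e ≤ a` for all `e`, then
`F(x ∨ 1_S) ≥ (1 - a)·f(S)`. -/
theorem stmt11 {V : Type*} [Fintype V] [DecidableEq V]
    (f : Finset V → ℝ)
    (hsub : ∀ A B : Finset V, A ⊆ B → ∀ e ∉ B,
      f (insert e A) - f A ≥ f (insert e B) - f B)
    (hnn : ∀ S : Finset V, 0 ≤ f S)
    (a : ℝ) (ha : a ∈ Set.Icc (0:ℝ) 1)
    (S : Finset V)
    (x : V → ℝ) (hx : ∀ e, x e ∈ Set.Icc (0:ℝ) 1) (hxa : ∀ e, x e ≤ a) :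
    multilinearExt f (fun e => max (x e) (if e ∈ S then (1:ℝ) else 0))
      ≥ (1 - a) * f S := by
  set y : V → ℝ := fun e => max (x e) (if e ∈ S then (1:ℝ) else 0) with hydef
  have hyS : ∀ e ∈ S, y e = 1 := fun e he => by simp [hydef, he, (hx e).2]
  have hyx : ∀ e ∉ S, y e = x e := fun e he => by simp [hydef, he, (hx e).1]
  have hy : ∀ e, 0 ≤ y e ∧ y e ≤ 1 := fun e => by
    by_cases he : e ∈ S
    · rw [hyS e he]; norm_num
    · rw [hyx e he]; exact hx e
  have h := aux_main f hsub hnn a S x y (fun e => (hx e).1) hxa hy hyx Finset.univ 0 ha.1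
    (fun e _ => (hx e).1)
  rw [zero_mul, add_zero] at h
  refine ge_iff_le.2 (h.trans (le_of_eq ?_))
  unfold multilinearExt
  rw [Finset.powerset_univ]
  refine Finset.sum_congr rfl fun T _ => ?_
  rw [← Finset.compl_eq_univ_sdiff]
  by_cases hST : S ⊆ T
  · rw [Finset.union_eq_right.2 hST]
  · obtain ⟨e, heS, heT⟩ := Finset.not_subset.1 hST
    have : ∏ i ∈ Tᶜ, (1 - y i) = 0 :=
      Finset.prod_eq_zero (Finset.mem_compl.2 heT) (by rw [hyS e heS, sub_self])
    rw [this]; simp
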